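/- Let n ∈ ℕ, R₀ > 0, and let a₁,…,aₙ ∈ B_{R₀}(0) ⊂ ℝ² be pairwise distinct points. Define the packing density σ = n · min{ minᵢ (R₀ − |aᵢ|)², min_{i≠j} (|aᵢ − aⱼ|/2)² } / R₀² (for n = 1 the second minimum is omitted). If either σ ≥ 1 and λ > 1, or σ < 1 and 1 < λ < 1/√(1 − σ), then the cavitation configuration ((aᵢ)ᵢ₌₁ⁿ, (vᵢ)ᵢ₌₁ⁿ) with equal areas v₁ = ⋯ = vₙ = (πR₀²/n)(λ² − 1) is attainable through an evolution of circular cavities. -/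

import Mathlib

open scoped BigOperators

/-- A cavitation configuration `(a, v)` attainable through an evolution of circular
cavities: the data of the evolutions `z` (centers) and `L` (radii) with all the
required properties, for the stretch factor `lam`. -/
def IsCircEvolution (n : ℕ) (R₀ lam : ℝ) (a : Fin n → ℂ) (v : Fin n → ℝ)
    (z : Fin n → ℝ → ℂ) (L : Fin n → ℝ → ℝ) : Prop :=
  (∀ i, ContDiffOn ℝ 1 (z i) (Set.Icc 1 lam)) ∧
  (∀ i, ∀ t ∈ Set.Icc (1:ℝ) lam, 0 ≤ L i t) ∧
  (∀ t ∈ Set.Icc (1:ℝ) lam, ∑ i, Real.pi * L i t ^ 2 = (t ^ 2 - 1) * Real.pi * R₀ ^ 2) ∧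
  (∀ i, ContDiffOn ℝ 1 (fun t => L i t ^ 2) (Set.Icc 1 lam)) ∧
  (∀ i, z i 1 = a i) ∧
  (∀ i, L i 1 = 0) ∧
  (∀ i, Real.pi * L i lam ^ 2 = v i) ∧
  (∀ t ∈ Set.Icc (1:ℝ) lam, Pairwise (fun i j =>
    Disjoint (Metric.closedBall (z i t) (L i t)) (Metric.closedBall (z j t) (L j t)))) ∧
  (∀ t ∈ Set.Icc (1:ℝ) lam, ∀ i, Metric.closedBall (z i t) (L i t) ⊆ Metric.ball (0:ℂ) (t * R₀))

/-- Closed balls of equal radius are disjoint when the centers are further apart than twice the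
radius. -/
lemma disjoint_closedBall_of_lt_half_norm_sub {x y : ℂ} {r : ℝ} (h : r < ‖x - y‖ / 2) :
    Disjoint (Metric.closedBall x r) (Metric.closedBall y r) := by
  apply Metric.closedBall_disjoint_closedBall
  rw [dist_eq_norm]
  linarith

/-- Dilating the centers linearly and growing the cavities with equal areas is an admissible
evolution, as long as the squared common radius stays below the dilated squared packing radius. -/
lemma isCircEvolution_dilation {n : ℕ} (hn : 0 < n) {R₀ lam m : ℝ} (hR₀ : 0 < R₀)
    (hlam : 1 < lam) {a : Fin n → ℂ} (ha : ∀ i, ‖a i‖ < R₀)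
    (hbd : ∀ i, m ≤ (R₀ - ‖a i‖) ^ 2)
    (hsep : ∀ i j, i ≠ j → m ≤ (‖a i - a j‖ / 2) ^ 2)
    (hm : ∀ t ∈ Set.Icc (1 : ℝ) lam, (t ^ 2 - 1) * R₀ ^ 2 / n < t ^ 2 * m) :
    IsCircEvolution n R₀ lam a (fun _ => Real.pi * R₀ ^ 2 / (n : ℝ) * (lam ^ 2 - 1))
      (fun i t => (t : ℂ) * a i) (fun _ t => √((t ^ 2 - 1) * R₀ ^ 2 / n)) := by
  have hn' : (0 : ℝ) < n := by exact_mod_cast hn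
  have hsq : ∀ t ∈ Set.Icc (1 : ℝ) lam,
      √((t ^ 2 - 1) * R₀ ^ 2 / n) ^ 2 = (t ^ 2 - 1) * R₀ ^ 2 / n := fun t ht => by
    have : 0 ≤ t ^ 2 - 1 := by nlinarith [ht.1]
    exact Real.sq_sqrt (by positivity)
  have hlt : ∀ t ∈ Set.Icc (1 : ℝ) lam, ∀ d : ℝ, 0 ≤ d → m ≤ d ^ 2 →
      √((t ^ 2 - 1) * R₀ ^ 2 / n) < t * d := fun t ht d hd hmd => by
    have ht0 : 0 ≤ t := by linarith [ht.1]
    refine lt_of_pow_lt_pow_left₀ 2 (by positivity) ?_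
    rw [hsq t ht, mul_pow]
    exact (hm t ht).trans_le (by gcongr)
  refine ⟨fun i => ?_, fun _ t _ => Real.sqrt_nonneg _, fun t ht => ?_, fun _ => ?_,
    fun i => by simp, fun _ => by simp, fun _ => ?_, fun t ht i j hij => ?_, fun t ht i => ?_⟩
  · exact (Complex.ofRealCLM.contDiff.mul contDiff_const).contDiffOn
  · simp only [hsq t ht, Finset.sum_const, Finset.card_univ, Fintype.card_fin, nsmul_eq_mul]
    field_simp
  · exact ContDiffOn.congr (by fun_prop) hsq
  · simp only [hsq lam ⟨hlam.le, le_rfl⟩]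
    field_simp
  · have ht0 : 0 ≤ t := by linarith [ht.1]
    apply disjoint_closedBall_of_lt_half_norm_sub
    rw [← mul_sub, norm_mul, Complex.norm_of_nonneg ht0, mul_div_assoc]
    exact hlt t ht _ (by positivity) (hsep i j hij)
  · have ht0 : 0 ≤ t := by linarith [ht.1]
    apply Metric.closedBall_subset_ball'
    rw [dist_zero_right, norm_mul, Complex.norm_of_nonneg ht0]
    linarith [hlt t ht _ (sub_nonneg.2 (ha i).le) (hbd i)]

/-- The two ranges of the stretch factor give a uniform bound on its square. -/
lemma sq_sub_one_lt_sq_mul {lam σ t : ℝ}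
    (hcase : (1 ≤ σ ∧ 1 < lam) ∨ (σ < 1 ∧ 1 < lam ∧ lam < 1 / √(1 - σ)))
    (ht : t ∈ Set.Icc 1 lam) : t ^ 2 - 1 < t ^ 2 * σ := by
  have ht1 : 1 ≤ t := ht.1
  rcases hcase with ⟨hσ, -⟩ | ⟨hσ, -, hlam⟩
  · nlinarith
  · have hpos : 0 < 1 - σ := by linarith
    have hs := Real.sqrt_pos.2 hpos
    have h1 : t * √(1 - σ) < 1 := (lt_div_iff₀ hs).1 (ht.2.trans_lt hlam)
    have h2 : (t * √(1 - σ)) ^ 2 < 1 := by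
      rw [sq_lt_one_iff₀ (by positivity)]
      exact h1
    rw [mul_pow, Real.sq_sqrt hpos.le] at h2
    linarith

theorem stmt_1 (n : ℕ) (R₀ : ℝ) (hR₀ : 0 < R₀) (a : Fin n → ℂ)
    (ha : ∀ i, a i ∈ Metric.ball (0:ℂ) R₀) (hdist : Function.Injective a)
    (lam σ : ℝ)
    (hσ : σ = (n : ℝ) * sInf ((Set.range fun i => (R₀ - ‖a i‖) ^ 2) ∪
      {x : ℝ | ∃ i j, i ≠ j ∧ x = (‖a i - a j‖ / 2) ^ 2}) / R₀ ^ 2)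
    (hcase : (1 ≤ σ ∧ 1 < lam) ∨ (σ < 1 ∧ 1 < lam ∧ lam < 1 / Real.sqrt (1 - σ))) :
    ∃ z L, IsCircEvolution n R₀ lam a
      (fun _ => Real.pi * R₀ ^ 2 / (n : ℝ) * (lam ^ 2 - 1)) z L := by
  have hlam : 1 < lam := hcase.elim (fun h => h.2) (fun h => h.2.1)
  have hn : 0 < n := by
    by_contra! h
    obtain rfl : n = 0 := by omega
    have := sq_sub_one_lt_sq_mul hcase ⟨hlam.le, le_rfl⟩
    simp only [hσ, Nat.cast_zero, zero_mul, zero_div, mul_zero] at this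
    nlinarith
  have hn' : (0 : ℝ) < n := by exact_mod_cast hn
  set S : Set ℝ := (Set.range fun i => (R₀ - ‖a i‖) ^ 2) ∪
    {x : ℝ | ∃ i j, i ≠ j ∧ x = (‖a i - a j‖ / 2) ^ 2}
  have hbdd : BddBelow S := by
    refine ⟨0, ?_⟩
    rintro x (⟨i, rfl⟩ | ⟨i, j, -, rfl⟩) <;> positivity
  refine ⟨_, _, isCircEvolution_dilation (m := sInf S) hn hR₀ hlam
    (fun i => mem_ball_zero_iff.1 (ha i)) (fun i => csInf_le hbdd (Or.inl ⟨i, rfl⟩))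
    (fun i j hij => csInf_le hbdd (Or.inr ⟨i, j, hij, rfl⟩)) fun t ht => ?_⟩
  have h := sq_sub_one_lt_sq_mul hcase ht
  rw [hσ, mul_div_assoc', lt_div_iff₀ (by positivity)] at h
  rw [div_lt_iff₀ hn']
  linarith
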